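/- Let p be a prime and a, b integers with 0 ≤ b ≤ a, a ≥ 1, and a ≡ b (mod p−1). Set α = (pa−b)/(p−1) and β = p(a−b)/(p−1), which are nonnegative integers. Then both sequences e ↦ S(p^e·a, p^e·b) and e ↦ C(p^e·α − 1, p^e·β), viewed in ℤ_p, converge as e → ∞, and their limits are equal. -/

import Mathlib

/-- Stirling numbers of the second kind for integer arguments:
`S(n,k) = (1/k!) ∑_{i=0}^{k} (-1)^(k-i) C(k,i) i^n` for `n, k ≥ 0` (with `0^0 = 1`),
and `S(n,k) = 0` if `n < 0` or `k < 0`. -/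
def stirling2 (n k : ℤ) : ℤ :=
  if n < 0 ∨ k < 0 then 0
  else (∑ i ∈ Finset.range (k.toNat + 1),
      (-1 : ℤ) ^ (k.toNat - i) * (Nat.choose k.toNat i : ℤ) * (i : ℤ) ^ n.toNat)
    / (Nat.factorial k.toNat : ℤ)

/-- Binomial coefficient for (nonnegative) integer arguments. -/
def ichoose (n k : ℤ) : ℤ := (Nat.choose n.toNat k.toNat : ℤ)

open Finset in
theorem sum_neg_one_pow_mul_choose_mul_pow_eq (n k : ℕ) :
    ∑ i ∈ range (k + 1), (-1 : ℤ) ^ (k - i) * (k.choose i : ℤ) * (i : ℤ) ^ n =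
      (k.factorial : ℤ) * (Nat.stirlingSecond n k : ℤ) := by
  induction n generalizing k with
  | zero =>
    have h := add_pow (1 : ℤ) (-1) k
    cases k with
    | zero => simp
    | succ k =>
      simp only [one_pow, one_mul, add_neg_cancel, ne_eq, Nat.succ_ne_zero, not_false_eq_true,
        zero_pow] at h
      rw [Nat.stirlingSecond_zero_succ, Nat.cast_zero, mul_zero]
      simpa using h.symm
  | succ n ih =>
    cases k with
    | zero => simp
    | succ k =>
      have key : ∑ i ∈ range (k + 1 + 1),
          (-1 : ℤ) ^ (k + 1 - i) * ((k + 1).choose i : ℤ) * (i : ℤ) ^ (n + 1) =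
          (k + 1 : ℤ) * (∑ i ∈ range (k + 1 + 1),
            (-1 : ℤ) ^ (k + 1 - i) * ((k + 1).choose i : ℤ) * (i : ℤ) ^ n +
          ∑ i ∈ range (k + 1), (-1 : ℤ) ^ (k - i) * (k.choose i : ℤ) * (i : ℤ) ^ n) := by
        rw [sum_range_succ _ (k + 1), sum_range_succ _ (k + 1), add_right_comm,
          ← sum_add_distrib, mul_add, mul_sum]
        congr 1
        · refine sum_congr rfl fun i hi => ?_
          have hik : i ≤ k := Nat.lt_succ_iff.mp (mem_range.mp hi)
          have hc : (k.choose i : ℤ) * (k + 1) = ((k + 1).choose i : ℤ) * (k + 1 - i) := by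
            have := Nat.choose_mul_succ_eq k i
            zify [hik.trans k.le_succ] at this
            exact this
          rw [Nat.succ_sub hik, pow_succ, pow_succ]
          linear_combination (-(-1 : ℤ) ^ (k - i) * (i : ℤ) ^ n) * hc
        · simp [pow_succ']
      rw [key, ih, ih, Nat.stirlingSecond_succ_succ, Nat.factorial_succ]
      push_cast
      ring

theorem stirling2_natCast (n k : ℕ) : stirling2 n k = (Nat.stirlingSecond n k : ℤ) := by
  have h : ¬((n : ℤ) < 0 ∨ (k : ℤ) < 0) := by omega
  rw [stirling2, if_neg h, Int.toNat_natCast, Int.toNat_natCast,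
    sum_neg_one_pow_mul_choose_mul_pow_eq,
    Int.mul_ediv_cancel_left _ (by exact_mod_cast k.factorial_ne_zero)]

section RisingProduct

open Polynomial Finset

/-- The polynomial `∏_{i=1}^{k} (1 - i X)`. -/
noncomputable def risingProd (k : ℕ) : ℤ[X] := ∏ i ∈ range k, (1 - ((i + 1 : ℕ) : ℤ[X]) * X)

theorem risingProd_mul_mk_stirlingSecond (k : ℕ) :
    (risingProd k : PowerSeries ℤ) *
      PowerSeries.mk (fun n => (Nat.stirlingSecond (n + k) k : ℤ)) = 1 := by
  induction k with
  | zero =>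
    ext n
    cases n <;> simp [risingProd, PowerSeries.coeff_one]
  | succ k ih =>
    have h : (1 - ((k + 1 : ℕ) : PowerSeries ℤ) * PowerSeries.X) *
        PowerSeries.mk (fun n => (Nat.stirlingSecond (n + (k + 1)) (k + 1) : ℤ)) =
        PowerSeries.mk (fun n => (Nat.stirlingSecond (n + k) k : ℤ)) := by
      ext n
      rw [sub_mul, one_mul, mul_assoc, ← nsmul_eq_mul, map_sub, map_nsmul]
      cases n with
      | zero => simp [Nat.stirlingSecond_self]
      | succ n =>
        rw [PowerSeries.coeff_succ_X_mul]
        simp only [PowerSeries.coeff_mk]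
        rw [show n + 1 + (k + 1) = (n + k + 1) + 1 by ring, Nat.stirlingSecond_succ_succ,
          show n + (k + 1) = n + k + 1 by ring, show n + 1 + k = n + k + 1 by ring]
        push_cast
        simp
    have hcast : (((k + 1 : ℕ) : ℤ[X]) : PowerSeries ℤ) = ((k + 1 : ℕ) : PowerSeries ℤ) :=
      map_natCast Polynomial.coeToPowerSeries.ringHom (k + 1)
    have hprod : (risingProd (k + 1) : PowerSeries ℤ) = (risingProd k : PowerSeries ℤ) *
        (1 - ((k + 1 : ℕ) : PowerSeries ℤ) * PowerSeries.X) := by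
      rw [risingProd, prod_range_succ, ← risingProd, Polynomial.coe_mul, Polynomial.coe_sub,
        Polynomial.coe_one, Polynomial.coe_mul, Polynomial.coe_X, hcast]
    rw [hprod, mul_assoc, h, ih]

theorem natCast_dvd_sub_iff_map_eq (N : ℕ) (A B : ℤ[X]) :
    (N : ℤ[X]) ∣ A - B ↔
      A.map (Int.castRingHom (ZMod N)) = B.map (Int.castRingHom (ZMod N)) := by
  rw [show (N : ℤ[X]) = C (N : ℤ) by simp, C_dvd_iff_dvd_coeff, Polynomial.ext_iff]
  refine forall_congr' fun i => ?_
  rw [coeff_map, coeff_map, coeff_sub, eq_intCast, eq_intCast, eq_comm,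
    ZMod.intCast_eq_intCast_iff_dvd_sub]

theorem natCast_dvd_risingProd_mul_sub_pow (N m : ℕ) :
    (N : ℤ[X]) ∣ risingProd (N * m) - risingProd N ^ m := by
  rw [natCast_dvd_sub_iff_map_eq, Polynomial.map_pow]
  simp only [risingProd, Polynomial.map_prod]
  induction m with
  | zero => simp
  | succ m ih =>
    rw [mul_add_one, prod_range_add, ih, pow_succ]
    congr 1
    refine prod_congr rfl fun i _ => ?_
    simp

theorem natCast_dvd_risingProd_sub (p : ℕ) [Fact p.Prime] :
    (p : ℤ[X]) ∣ risingProd p - (1 - X ^ (p - 1)) := by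
  have hp : 1 < p := (Fact.out : p.Prime).one_lt
  rw [natCast_dvd_sub_iff_map_eq]
  obtain ⟨q, rfl⟩ : ∃ q, p = q + 1 := ⟨p - 1, by omega⟩
  have hq : ((q + 1 : ℕ) : (ZMod (q + 1))[X]) = 0 := by
    rw [← map_natCast C, ZMod.natCast_self, map_zero]
  have hmap : (risingProd (q + 1)).map (Int.castRingHom (ZMod (q + 1))) =
      ∏ i ∈ range q, (1 - ((i + 1 : ℕ) : (ZMod (q + 1))[X]) * X) := by
    rw [risingProd, Polynomial.map_prod, prod_range_succ]
    simp only [Polynomial.map_sub, Polynomial.map_one, Polynomial.map_mul,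
      Polynomial.map_natCast, map_X, hq, zero_mul, sub_zero, mul_one]
  rw [hmap]
  have hright : (1 - X ^ (q + 1 - 1) : ℤ[X]).map (Int.castRingHom (ZMod (q + 1))) =
      1 - X ^ q := by simp
  rw [hright]
  refine eq_of_degrees_lt_of_eval_finset_eq (Finset.univ : Finset (ZMod (q + 1))) ?_ ?_ ?_
  · rw [Finset.card_univ, ZMod.card]
    refine (degree_prod_le _ _).trans_lt ?_
    refine (Finset.sum_le_card_nsmul _ _ 1 fun i _ => ?_).trans_lt ?_
    · rw [← map_natCast C]
      compute_degree
    · simp only [card_range, nsmul_eq_mul, mul_one]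
      exact_mod_cast q.lt_succ_self
  · rw [Finset.card_univ, ZMod.card]
    refine lt_of_le_of_lt (b := (q : WithBot ℕ)) ?_ (by exact_mod_cast q.lt_succ_self)
    compute_degree
    exact le_rfl
  · intro x _
    rw [eval_prod]
    by_cases hx : x = 0
    · have : q ≠ 0 := by omega
      simp [hx, this]
    · have h1 : x ^ q = 1 := by simpa using ZMod.pow_card_sub_one_eq_one hx
      have h0 : eval x (1 - X ^ q : (ZMod (q + 1))[X]) = 0 := by simp [h1]
      rw [h0]
      have hv : (x⁻¹).val ≠ 0 := by simpa [ZMod.val_eq_zero] using hx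
      have hlt := ZMod.val_lt (x⁻¹)
      refine prod_eq_zero (i := (x⁻¹).val - 1) (mem_range.mpr (by omega)) ?_
      rw [show (x⁻¹).val - 1 + 1 = (x⁻¹).val by omega]
      rw [eval_sub, eval_mul, eval_natCast, eval_X, eval_one, ZMod.natCast_zmod_val,
        inv_mul_cancel₀ hx, sub_self]

theorem pow_succ_dvd_sub_pow_of_pow_dvd_sub {R : Type*} [CommRing R] {p k : ℕ} (hk : k ≠ 0)
    {a b : R} (h : (p : R) ^ k ∣ a - b) : (p : R) ^ (k + 1) ∣ a ^ p - b ^ p := by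
  rw [← geom_sum₂_mul, pow_succ']
  refine mul_dvd_mul ?_ h
  have hI : Ideal.Quotient.mk (Ideal.span {(p : R)}) a =
      Ideal.Quotient.mk (Ideal.span {(p : R)}) b := by
    rw [Ideal.Quotient.eq, Ideal.mem_span_singleton]
    exact (dvd_pow_self _ hk).trans h
  rw [← Ideal.mem_span_singleton, ← Ideal.Quotient.eq_zero_iff_mem, RingHom.map_geom_sum₂, hI,
    geom_sum₂_self]
  have hp : (p : R ⧸ Ideal.span {(p : R)}) = 0 := by
    rw [← map_natCast (Ideal.Quotient.mk _), Ideal.Quotient.eq_zero_iff_mem]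
    exact Ideal.mem_span_singleton_self _
  rw [hp, zero_mul]

theorem pow_dvd_risingProd_pow_sub (p : ℕ) [Fact p.Prime] (k : ℕ) :
    (p : ℤ[X]) ^ (k + 1) ∣ risingProd (p ^ (k + 2)) - (1 - X ^ (p - 1)) ^ p ^ (k + 1) := by
  induction k with
  | zero =>
    have h1 : (p : ℤ[X]) ∣ risingProd (p * p) - risingProd p ^ p :=
      natCast_dvd_risingProd_mul_sub_pow p p
    have h2 := (natCast_dvd_risingProd_sub p).trans (sub_dvd_pow_sub_pow _ _ p)
    simpa [sq] using dvd_add h1 h2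
  | succ k ih =>
    have h1 := natCast_dvd_risingProd_mul_sub_pow (p ^ (k + 2)) p
    have h2 := pow_succ_dvd_sub_pow_of_pow_dvd_sub k.succ_ne_zero ih
    rw [Nat.cast_pow, ← pow_succ] at h1
    rw [← pow_mul, ← pow_succ] at h2
    simpa using dvd_add h1 h2

theorem pow_dvd_risingProd_pow_mul_sub (p : ℕ) [Fact p.Prime] (k b : ℕ) :
    (p : ℤ[X]) ^ (k + 1) ∣
      risingProd (p ^ (k + 2) * b) - (1 - X ^ (p - 1)) ^ (p ^ (k + 1) * b) := by
  have h1 := natCast_dvd_risingProd_mul_sub_pow (p ^ (k + 2)) b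
  rw [Nat.cast_pow] at h1
  have h2 := (pow_dvd_risingProd_pow_sub p k).trans (sub_dvd_pow_sub_pow _ _ b)
  rw [pow_mul]
  simpa using dvd_add ((pow_dvd_pow _ (k + 1).le_succ).trans h1) h2

theorem pow_dvd_one_sub_X_pow_sub (p : ℕ) [Fact p.Prime] (k b : ℕ) :
    (p : ℤ[X]) ^ (k + 1) ∣ (1 - X) ^ (p ^ (k + 1) * b) - (1 - X ^ p) ^ (p ^ k * b) := by
  have h : (p : ℤ[X]) ∣ (1 - X) ^ p - (1 - X ^ p) := by
    rw [natCast_dvd_sub_iff_map_eq]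
    simp [sub_pow_char]
  have h2 := (dvd_sub_pow_of_dvd_sub h k).trans (sub_dvd_pow_sub_pow _ _ b)
  rwa [← pow_mul, ← pow_mul, ← pow_mul, ← mul_assoc, ← pow_succ'] at h2

end RisingProduct

section Coefficients

open PowerSeries

theorem dvd_coeff_sub_of_dvd_sub {R : Type*} [CommRing R] {d : R} {A B F G : R⟦X⟧}
    (hF : A * F = 1) (hG : B * G = 1) (h : C d ∣ A - B) (n : ℕ) :
    d ∣ coeff n F - coeff n G := by
  obtain ⟨D, hD⟩ := h
  have h2 : F - G = C d * (-(D * F * G)) := by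
    linear_combination (-F * G) * hD - F * hG + G * hF
  rw [← map_sub, h2, coeff_C_mul]
  exact dvd_mul_right _ _

theorem natCast_pow_dvd_coeff_sub {p m : ℕ} {A B : Polynomial ℤ} {F G : ℤ⟦X⟧}
    (hF : (A : ℤ⟦X⟧) * F = 1) (hG : (B : ℤ⟦X⟧) * G = 1)
    (h : (p : Polynomial ℤ) ^ m ∣ A - B) (n : ℕ) :
    (p : ℤ) ^ m ∣ coeff n F - coeff n G := by
  refine dvd_coeff_sub_of_dvd_sub hF hG ?_ n
  have h2 := map_dvd Polynomial.coeToPowerSeries.ringHom h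
  rw [map_pow, map_natCast, map_sub] at h2
  rwa [map_pow, map_natCast]

theorem one_sub_X_pow_mul_expand_invOneSubPow (q : ℕ) (hq : q ≠ 0) (M : ℕ) :
    (((1 - Polynomial.X ^ q) ^ M : Polynomial ℤ) : ℤ⟦X⟧) *
      expand q hq (invOneSubPow ℤ M).val = 1 := by
  have h : ((1 - X) ^ M : ℤ⟦X⟧) * (invOneSubPow ℤ M).val = 1 := by
    rw [← invOneSubPow_inv_eq_one_sub_pow]
    exact (invOneSubPow ℤ M).inv_val
  simpa using congrArg (expand q hq) h

theorem pow_dvd_coeff_invOneSubPow_sub (p : ℕ) [Fact p.Prime] (k b n : ℕ) :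
    (p : ℤ) ^ (k + 1) ∣ coeff (p ^ (k + 1) * n) (invOneSubPow ℤ (p ^ (k + 1) * b)).val -
      coeff (p ^ k * n) (invOneSubPow ℤ (p ^ k * b)).val := by
  have hp : p ≠ 0 := (Fact.out : p.Prime).ne_zero
  have h := natCast_pow_dvd_coeff_sub
    (by simpa using one_sub_X_pow_mul_expand_invOneSubPow 1 one_ne_zero (p ^ (k + 1) * b))
    (one_sub_X_pow_mul_expand_invOneSubPow p hp (p ^ k * b))
    (pow_dvd_one_sub_X_pow_sub p k b) (p * (p ^ k * n))
  rwa [coeff_expand_mul, ← mul_assoc, ← pow_succ'] at h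

theorem pow_dvd_stirlingSecond_sub (p : ℕ) [Fact p.Prime] (k b n : ℕ) :
    (p : ℤ) ^ (k + 1) ∣
      (Nat.stirlingSecond ((p - 1) * (p ^ (k + 1) * n) + p ^ (k + 2) * b) (p ^ (k + 2) * b) : ℤ) -
      coeff (p ^ (k + 1) * n) (invOneSubPow ℤ (p ^ (k + 1) * b)).val := by
  have hp : p - 1 ≠ 0 := by have := (Fact.out : p.Prime).one_lt; omega
  have h := natCast_pow_dvd_coeff_sub
    (risingProd_mul_mk_stirlingSecond (p ^ (k + 2) * b))
    (one_sub_X_pow_mul_expand_invOneSubPow (p - 1) hp (p ^ (k + 1) * b))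
    (pow_dvd_risingProd_pow_mul_sub p k b) ((p - 1) * (p ^ (k + 1) * n))
  rwa [coeff_expand_mul, coeff_mk] at h

theorem choose_eq_coeff_invOneSubPow {m n : ℕ} (h : 0 < m + n) :
    ((m + n - 1).choose n : ℤ) = coeff n (invOneSubPow ℤ m).val := by
  cases m with
  | zero =>
    have hn : n ≠ 0 := by omega
    rw [invOneSubPow_zero, Units.val_one, coeff_one, if_neg hn,
      Nat.choose_eq_zero_of_lt (by omega), Nat.cast_zero]
  | succ m =>
    rw [invOneSubPow_val_succ_eq_mk_add_choose, coeff_mk,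
      show m + 1 + n - 1 = m + n by omega, Nat.choose_symm_add]

end Coefficients

theorem PadicInt.exists_tendsto_intCast_of_pow_dvd_sub (p : ℕ) [Fact p.Prime] (c : ℕ → ℤ)
    (h : ∀ k, (p : ℤ) ^ k ∣ c (k + 1) - c k) :
    ∃ L : ℤ_[p], Filter.Tendsto (fun k => (c k : ℤ_[p])) Filter.atTop (nhds L) := by
  have hp : (1 : ℝ) < p := by exact_mod_cast (Fact.out : p.Prime).one_lt
  refine cauchySeq_tendsto_of_complete
    (cauchySeq_of_le_geometric ((p : ℝ)⁻¹) 1 (inv_lt_one_of_one_lt₀ hp) fun k => ?_)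
  rw [dist_comm, dist_eq_norm, one_mul, inv_pow, ← zpow_natCast, ← zpow_neg, ← Int.cast_sub]
  exact PadicInt.norm_int_le_pow_iff_dvd.mpr (h k)

theorem PadicInt.tendsto_intCast_of_pow_dvd_sub (p : ℕ) [Fact p.Prime] {c s : ℕ → ℤ} {L : ℤ_[p]}
    (hc : Filter.Tendsto (fun k => (c k : ℤ_[p])) Filter.atTop (nhds L))
    (h : ∀ k, (p : ℤ) ^ k ∣ s k - c k) :
    Filter.Tendsto (fun k => (s k : ℤ_[p])) Filter.atTop (nhds L) := by
  have hp : (1 : ℝ) < p := by exact_mod_cast (Fact.out : p.Prime).one_lt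
  have h0 : Filter.Tendsto (fun k => ((s k - c k : ℤ) : ℤ_[p])) Filter.atTop (nhds 0) := by
    refine squeeze_zero_norm (fun k => PadicInt.norm_int_le_pow_iff_dvd.mpr (h k)) ?_
    simp only [zpow_neg, zpow_natCast, ← inv_pow]
    exact tendsto_pow_atTop_nhds_zero_of_lt_one (by positivity) (inv_lt_one_of_one_lt₀ hp)
  simpa using h0.add hc

theorem padic_limit_stirling2_eq_limit_binom (p : ℕ) [Fact p.Prime] (a b α β : ℤ)
    (hb : 0 ≤ b) (hba : b ≤ a) (ha : 1 ≤ a)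
    (hab : Int.ModEq ((p : ℤ) - 1) a b)
    (hα : α * ((p : ℤ) - 1) = (p : ℤ) * a - b)
    (hβ : β * ((p : ℤ) - 1) = (p : ℤ) * (a - b)) :
    ∃ L : ℤ_[p],
      Filter.Tendsto
        (fun e : ℕ => ((stirling2 ((p : ℤ) ^ e * a) ((p : ℤ) ^ e * b) : ℤ) : ℤ_[p]))
        Filter.atTop (nhds L) ∧
      Filter.Tendsto
        (fun e : ℕ => ((ichoose ((p : ℤ) ^ e * α - 1) ((p : ℤ) ^ e * β) : ℤ) : ℤ_[p]))
        Filter.atTop (nhds L) := by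
  obtain ⟨b, rfl⟩ := Int.eq_ofNat_of_zero_le hb
  have hp : 1 < p := (Fact.out : p.Prime).one_lt
  have hp' : (0 : ℤ) < (p : ℤ) - 1 := by
    have : (1 : ℤ) < p := by exact_mod_cast hp
    omega
  have hβ0 : 0 ≤ β := by
    refine nonneg_of_mul_nonneg_left ?_ hp'
    rw [hβ]
    exact mul_nonneg (by positivity) (by omega)
  obtain ⟨n, rfl⟩ := Int.eq_ofNat_of_zero_le hβ0
  obtain ⟨d, hd⟩ := Int.eq_ofNat_of_zero_le (sub_nonneg.mpr hba)
  obtain rfl : a = ((d + b : ℕ) : ℤ) := by push_cast; omega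
  have hαn : α = ((b + n : ℕ) : ℤ) := by
    refine mul_right_cancel₀ hp'.ne' ?_
    push_cast at hα hβ ⊢
    linear_combination hα - hβ
  subst hαn
  have hdn : p * d = (p - 1) * n := by
    zify [hp.le]
    push_cast at hβ
    linear_combination -hβ
  have hbn : 0 < b + n := by
    by_contra h0
    obtain ⟨rfl, rfl⟩ : b = 0 ∧ n = 0 := by omega
    have : d = 0 := by simpa [(zero_lt_one.trans hp).ne'] using hdn
    simp [this] at ha
  set c : ℕ → ℤ := fun e =>
    PowerSeries.coeff (p ^ e * n) (PowerSeries.invOneSubPow ℤ (p ^ e * b)).val with hc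
  have hchoose : ∀ e, ichoose ((p : ℤ) ^ e * ((b + n : ℕ) : ℤ) - 1) ((p : ℤ) ^ e * (n : ℤ)) =
      c e := fun e => by
    have hpos : 0 < p ^ e * b + p ^ e * n := by rw [← mul_add]; positivity
    simp only [hc]
    rw [← choose_eq_coeff_invOneSubPow hpos, ichoose,
      show (p : ℤ) ^ e * ((b + n : ℕ) : ℤ) - 1 = ((p ^ e * b + p ^ e * n - 1 : ℕ) : ℤ) by
        rw [Nat.cast_sub hpos]; push_cast; ring,
      show (p : ℤ) ^ e * (n : ℤ) = ((p ^ e * n : ℕ) : ℤ) by push_cast; rfl,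
      Int.toNat_natCast, Int.toNat_natCast]
  obtain ⟨L, hL⟩ := PadicInt.exists_tendsto_intCast_of_pow_dvd_sub p c fun k =>
    (pow_dvd_pow _ k.le_succ).trans (pow_dvd_coeff_invOneSubPow_sub p k b n)
  refine ⟨L, ?_, by simpa only [hchoose] using hL⟩
  rw [← Filter.tendsto_add_atTop_iff_nat 2]
  refine PadicInt.tendsto_intCast_of_pow_dvd_sub p
    ((Filter.tendsto_add_atTop_iff_nat 1).mpr hL) fun k => ?_
  have hk : p ^ (k + 2) * (d + b) = (p - 1) * (p ^ (k + 1) * n) + p ^ (k + 2) * b := by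
    rw [mul_add, pow_succ, mul_assoc, hdn]
    ring
  have hs : stirling2 ((p : ℤ) ^ (k + 2) * ((d + b : ℕ) : ℤ)) ((p : ℤ) ^ (k + 2) * (b : ℤ)) =
      (Nat.stirlingSecond ((p - 1) * (p ^ (k + 1) * n) + p ^ (k + 2) * b)
        (p ^ (k + 2) * b) : ℤ) := by
    rw [← hk, ← stirling2_natCast]
    push_cast
    rfl
  refine (pow_dvd_pow _ k.le_succ).trans ?_
  have h := pow_dvd_stirlingSecond_sub p k b n
  rwa [← hs] at h
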